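/- arXiv:1611.05498 — 2 statements merged into one kernel-verified Lean document; each statement's English description precedes it below -/
import Mathlib

section
/- Let h : 𝕋² → S¹ be a horizontal map. Then for every ε > 0 the set { t ∈ S¹ : uw(h⁻¹(t)) ≥ ε } is finite. -/
/- STATEMENT 5: For a horizontal map `h : 𝕋² → S¹` and every `ε > 0`, only
finitely many fibers `h⁻¹(t)` have upper width at least `ε` (the upper width of
a horizontal annular continuum being that of any connected component of its
`θ`-preimage in the annulus). -/

noncomputable section
open Set Metric Filter Topology Function

abbrev 𝕊 : Type := AddCircle (1:ℝ)
abbrev 𝔸 : Type := 𝕊 × ℝ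
abbrev 𝕋2 : Type := 𝕊 × 𝕊

def τ : ℝ × ℝ → 𝔸 := fun p => ((p.1 : 𝕊), p.2)
def θ : 𝔸 → 𝕋2 := fun p => (p.1, (p.2 : 𝕊))

/-- The connected components of a set `S ⊆ 𝔸`. -/
def comps (S : Set 𝔸) : Set (Set 𝔸) := {C | ∃ z ∈ S, C = connectedComponentIn S z}

/-- A subset of the annulus is unbounded above. -/
def UnbAbove (C : Set 𝔸) : Prop := ¬ BddAbove (Prod.snd '' C)
/-- A subset of the annulus is unbounded below. -/
def UnbBelow (C : Set 𝔸) : Prop := ¬ BddBelow (Prod.snd '' C)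

/-- An essential continuum: a compact connected set whose complement has exactly two
unbounded connected components, one unbounded above, the other unbounded below. -/
def IsEssentialContinuum (E : Set 𝔸) : Prop :=
  IsCompact E ∧ IsConnected E ∧
  ∃ U V : Set 𝔸, U ∈ comps Eᶜ ∧ V ∈ comps Eᶜ ∧ U ≠ V ∧
    UnbAbove U ∧ ¬ UnbBelow U ∧ UnbBelow V ∧ ¬ UnbAbove V ∧
    ∀ C ∈ comps Eᶜ, ¬ Bornology.IsBounded C → C = U ∨ C = V

/-- The lower unbounded complementary region `U⁻(E)` of an essential continuum. -/
def Uminus (E : Set 𝔸) : Set 𝔸 :=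
  {z | z ∉ E ∧ UnbBelow (connectedComponentIn Eᶜ z)}

/-- The partial order `C₁ ≺ C₂` on essential continua. -/
def Prec (C₁ C₂ : Set 𝔸) : Prop := C₁ ⊆ Uminus C₂

/-- An essential annular continuum: a compact connected set whose complement has
exactly two connected components, both unbounded. -/
def IsEssentialAnnularContinuum (E : Set 𝔸) : Prop :=
  IsCompact E ∧ IsConnected E ∧
  ∃ U V : Set 𝔸, U ∈ comps Eᶜ ∧ V ∈ comps Eᶜ ∧ U ≠ V ∧
    UnbAbove U ∧ UnbBelow V ∧ ∀ C ∈ comps Eᶜ, C = U ∨ C = V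

/-- The infimum distance between two subsets of the annulus. -/
def setDist (s t : Set 𝔸) : ℝ := sInf {r | ∃ x ∈ s, ∃ y ∈ t, r = dist x y}

/-- The upper width of `A ⊆ 𝔸`. -/
def uw (A : Set 𝔸) : ℝ :=
  sSup {r | ∃ C₁ C₂ : Set 𝔸, IsEssentialContinuum C₁ ∧ IsEssentialContinuum C₂ ∧
    C₁ ⊆ A ∧ C₂ ⊆ A ∧ r = hausdorffDist C₁ C₂}

/-- The lower width of `A ⊆ 𝔸`. -/
def lw (A : Set 𝔸) : ℝ :=
  sSup {r | ∃ C₁ C₂ : Set 𝔸, IsEssentialContinuum C₁ ∧ IsEssentialContinuum C₂ ∧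
    C₁ ⊆ A ∧ C₂ ⊆ A ∧ r = setDist C₁ C₂}

/-- A horizontal annular continuum in the torus. -/
def IsHorizontalAnnularContinuum (C : Set 𝕋2) : Prop :=
  IsCompact C ∧ IsConnected C ∧
  ∀ z ∈ θ ⁻¹' C, IsEssentialAnnularContinuum (connectedComponentIn (θ ⁻¹' C) z)

/-- A horizontal map `h : 𝕋² → S¹`. -/
def IsHorizontalMap (h : 𝕋2 → 𝕊) : Prop :=
  Continuous h ∧ Function.Surjective h ∧ ∀ t : 𝕊, IsHorizontalAnnularContinuum (h ⁻¹' {t})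

/-- The lower density of a set of natural numbers. -/
def lowerDensity (G : Set ℕ) : ℝ :=
  liminf (fun n : ℕ => ((G ∩ Set.Icc 1 n).ncard : ℝ) / n) atTop

/-- An essential simple loop, regarded as a subset of the annulus. -/
def IsEssentialSimpleLoop (Γ : Set 𝔸) : Prop :=
  (∃ γ : 𝕊 → 𝔸, Continuous γ ∧ Function.Injective γ ∧ Γ = Set.range γ) ∧
  IsEssentialContinuum Γ

/-- A closed essential topological annulus: a homeomorphic copy of `S¹ × [0,1]`
containing an essential loop. -/
def IsClosedEssentialAnnulus (A : Set 𝔸) : Prop :=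
  (∃ φ : 𝕊 × (Set.Icc (0:ℝ) 1) → 𝔸, Continuous φ ∧ Function.Injective φ ∧ A = Set.range φ) ∧
  ∃ Γ ⊆ A, IsEssentialSimpleLoop Γ

/-! ### Topology of the annulus -/

theorem IsPreconnected.exists_mem_frontier {X : Type*} [TopologicalSpace X] {s t : Set X}
    (hs : IsPreconnected s) (h₁ : (s ∩ t).Nonempty) (h₂ : (s ∩ tᶜ).Nonempty) :
    (s ∩ frontier t).Nonempty := by
  by_contra hne
  have hcov : s ⊆ interior t ∪ (closure t)ᶜ := by
    intro x hx
    by_contra hx'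
    rw [mem_union, not_or, notMem_compl_iff] at hx'
    exact hne ⟨x, hx, hx'.2, hx'.1⟩
  obtain ⟨x, hxs, hxt⟩ := h₁
  obtain ⟨y, hys, hyt⟩ := h₂
  have hx : x ∈ interior t := (hcov hxs).resolve_right fun h => h (subset_closure hxt)
  have hy : y ∈ (closure t)ᶜ := (hcov hys).resolve_left fun h => hyt (interior_subset h)
  obtain ⟨w, -, hw₁, hw₂⟩ := hs _ _ isOpen_interior isClosed_closure.isOpen_compl hcov
    ⟨x, hxs, hx⟩ ⟨y, hys, hy⟩
  exact hw₂ (subset_closure (interior_subset hw₁))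

theorem isPreconnected_ball_circle (x : 𝕊) (r : ℝ) : IsPreconnected (ball x r) := by
  obtain ⟨y, rfl⟩ := QuotientAddGroup.mk_surjective x
  have : ball ((y : ℝ) : 𝕊) r = (fun t : ℝ => (t : 𝕊)) '' ball y r := by
    ext z
    constructor
    · intro hz
      rw [mem_ball, dist_eq_norm, QuotientAddGroup.norm_lt_iff] at hz
      obtain ⟨m, hm, hmr⟩ := hz
      refine ⟨m + y, by simpa [dist_eq_norm] using hmr, ?_⟩
      change ((m + y : ℝ) : 𝕊) = z
      rw [AddCircle.coe_add]
      exact eq_sub_iff_add_eq.mp hm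
    · rintro ⟨t, ht, rfl⟩
      rw [mem_ball, dist_eq_norm] at ht ⊢
      rw [QuotientAddGroup.norm_lt_iff]
      exact ⟨t - y, rfl, ht⟩
  rw [show ((QuotientAddGroup.mk y : 𝕊)) = ((y : ℝ) : 𝕊) from rfl, this]
  exact (convex_ball y r).isPreconnected.image _ (AddCircle.continuous_mk' 1).continuousOn

theorem isPreconnected_ball_annulus (z : 𝔸) (r : ℝ) : IsPreconnected (ball z r) := by
  rw [← Prod.mk.eta (p := z), ← ball_prod_same]
  exact (isPreconnected_ball_circle _ _).prod (convex_ball _ _).isPreconnected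

/-- The translation of the annulus by `k` in the vertical direction. -/
def vshift (k : ℝ) : 𝔸 ≃ᵢ 𝔸 := IsometryEquiv.addRight ((0 : 𝕊), k)

@[simp] theorem vshift_apply (k : ℝ) (z : 𝔸) : vshift k z = (z.1, z.2 + k) := by
  simp [vshift, Prod.ext_iff]

theorem θ_vshift (k : ℤ) (z : 𝔸) : θ (vshift k z) = θ z := by
  simp only [θ, vshift_apply, AddCircle.coe_add]
  have : ((k : ℝ) : 𝕊) = 0 := by
    rw [AddCircle.coe_eq_zero_iff]
    exact ⟨k, by simp⟩
  rw [this, add_zero]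

/-! ### The lower complementary region -/

theorem disjoint_Uminus (E : Set 𝔸) : Disjoint E (Uminus E) :=
  Set.disjoint_left.mpr fun _ hz hz' => hz'.1 hz

theorem IsPreconnected.subset_Uminus {K E : Set 𝔸} (hK : IsPreconnected K) (hd : Disjoint K E)
    (hne : (K ∩ Uminus E).Nonempty) : K ⊆ Uminus E := by
  obtain ⟨z, hzK, hzE, hz⟩ := hne
  intro w hw
  have hsub : K ⊆ _root_.connectedComponentIn Eᶜ z :=
    hK.subset_connectedComponentIn hzK hd.subset_compl_right
  refine ⟨Set.disjoint_left.mp hd hw, ?_⟩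
  rwa [← connectedComponentIn_eq (hsub hw)]

theorem Iio_subset_Uminus {E : Set 𝔸} {m : ℝ} (hE : ∀ z ∈ E, m ≤ z.2) :
    {z : 𝔸 | z.2 < m} ⊆ Uminus E := by
  intro z hz
  have hd : (univ : Set 𝕊) ×ˢ Iio m ⊆ Eᶜ := fun w hw hwE => (hE w hwE).not_gt hw.2
  have hsub : (univ : Set 𝕊) ×ˢ Iio m ⊆ connectedComponentIn Eᶜ z :=
    (isPreconnected_univ.prod isPreconnected_Iio).subset_connectedComponentIn ⟨trivial, hz⟩ hd
  refine ⟨hd ⟨trivial, hz⟩, fun ⟨b, hb⟩ => ?_⟩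
  have hlt : min b m - 1 < m := by linarith [min_le_right b m]
  have := hb ⟨((0 : 𝕊), min b m - 1), hsub ⟨trivial, hlt⟩, rfl⟩
  have h' : b ≤ min b m - 1 := this
  linarith [min_le_left b m]

theorem IsCompact.exists_forall_le_snd {E : Set 𝔸} (hE : IsCompact E) :
    ∃ m : ℝ, ∀ z ∈ E, m ≤ z.2 := by
  obtain ⟨m, hm⟩ := (hE.image continuous_snd).bddBelow
  exact ⟨m, fun z hz => hm ⟨z, hz, rfl⟩⟩

theorem IsCompact.exists_forall_snd_le {E : Set 𝔸} (hE : IsCompact E) :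
    ∃ m : ℝ, ∀ z ∈ E, z.2 ≤ m := by
  obtain ⟨m, hm⟩ := (hE.image continuous_snd).bddAbove
  exact ⟨m, fun z hz => hm ⟨z, hz, rfl⟩⟩

theorem isPreconnected_Uminus {E : Set 𝔸} (hE : IsCompact E) : IsPreconnected (Uminus E) := by
  obtain ⟨m, hm⟩ := hE.exists_forall_le_snd
  have key : Uminus E ⊆ connectedComponentIn Eᶜ ((0 : 𝕊), m - 1) := by
    rintro z ⟨hzE, hz⟩
    obtain ⟨-, ⟨w, hw, rfl⟩, hwm⟩ := not_bddBelow_iff.mp hz m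
    have hd : (univ : Set 𝕊) ×ˢ Iio m ⊆ Eᶜ := fun w hw hwE => (hm w hwE).not_gt hw.2
    have hsub : (univ : Set 𝕊) ×ˢ Iio m ⊆ connectedComponentIn Eᶜ w :=
      (isPreconnected_univ.prod isPreconnected_Iio).subset_connectedComponentIn ⟨trivial, hwm⟩ hd
    have hp : ((0 : 𝕊), m - 1) ∈ connectedComponentIn Eᶜ w := hsub ⟨trivial, sub_one_lt m⟩
    rw [← connectedComponentIn_eq hp, ← connectedComponentIn_eq hw]
    exact mem_connectedComponentIn hzE
  have hsub : connectedComponentIn Eᶜ ((0 : 𝕊), m - 1) ⊆ Uminus E :=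
    isPreconnected_connectedComponentIn.subset_Uminus
      (Set.disjoint_left.mpr fun w hw => connectedComponentIn_subset _ _ hw)
      ⟨((0 : 𝕊), m - 1), mem_connectedComponentIn fun h => (hm _ h).not_gt (sub_one_lt m),
        Iio_subset_Uminus hm (sub_one_lt m)⟩
  rw [key.antisymm hsub]
  exact isPreconnected_connectedComponentIn

theorem closure_Uminus_subset {E : Set 𝔸} (hE : IsClosed E) :
    closure (Uminus E) ⊆ Uminus E ∪ E := by
  intro z hz
  by_cases hzE : z ∈ E
  · exact Or.inr hzE
  left
  obtain ⟨r, hr, hball⟩ := Metric.isOpen_iff.mp hE.isOpen_compl z hzE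
  obtain ⟨w, hw, hwz⟩ := Metric.mem_closure_iff.mp hz r hr
  exact (isPreconnected_ball_annulus z r).subset_Uminus
    (Set.disjoint_left.mpr fun _ h => hball h) ⟨w, by rwa [mem_ball, dist_comm], hw⟩
    (mem_ball_self hr)

theorem isOpen_Uminus {E : Set 𝔸} (hE : IsClosed E) : IsOpen (Uminus E) := by
  rw [Metric.isOpen_iff]
  intro z hz
  obtain ⟨r, hr, hball⟩ := Metric.isOpen_iff.mp hE.isOpen_compl z hz.1
  exact ⟨r, hr, (isPreconnected_ball_annulus z r).subset_Uminus
    (Set.disjoint_left.mpr fun _ h => hball h) ⟨z, mem_ball_self hr, hz⟩⟩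

theorem frontier_Uminus_subset {E : Set 𝔸} (hE : IsClosed E) : frontier (Uminus E) ⊆ E := by
  rw [(isOpen_Uminus hE).frontier_eq]
  exact fun z hz => (closure_Uminus_subset hE hz.1).resolve_left hz.2

theorem isClosed_Uminus_union {E : Set 𝔸} (hE : IsClosed E) : IsClosed (Uminus E ∪ E) := by
  refine isClosed_of_closure_subset ?_
  rw [closure_union, hE.closure_eq]
  exact union_subset (closure_Uminus_subset hE) subset_union_right

/-! ### Separating continua -/

/-- A compact connected set whose lower complementary region is bounded above. -/
structure IsSeparating (E : Set 𝔸) : Prop where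
  isCompact : IsCompact E
  isConnected : IsConnected E
  bddAbove : BddAbove (Prod.snd '' Uminus E)

theorem IsEssentialContinuum.isSeparating {E : Set 𝔸} (hE : IsEssentialContinuum E) :
    IsSeparating E := by
  obtain ⟨hc, hconn, U, V, hU, hV, -, -, hUb, hVb, hVa, huniq⟩ := hE
  refine ⟨hc, hconn, (not_not.mp hVa).mono (image_mono ?_)⟩
  rintro z ⟨hzE, hz⟩
  have hnb : ¬ Bornology.IsBounded (connectedComponentIn Eᶜ z) := fun hb =>
    hz hb.image_snd.bddBelow
  rcases huniq _ ⟨z, hzE, rfl⟩ hnb with h | h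
  · exact absurd (h ▸ hz) hUb
  · exact h ▸ mem_connectedComponentIn hzE

theorem Uminus_image_vshift (E : Set 𝔸) (k : ℝ) :
    Uminus (vshift k '' E) = vshift k '' Uminus E := by
  ext z
  obtain ⟨w, rfl⟩ := (vshift k).surjective z
  rw [(vshift k).injective.mem_set_image]
  simp only [Uminus, mem_ofPred_eq, (vshift k).injective.mem_set_image]
  refine and_congr_right fun hw => ?_
  have himg : connectedComponentIn (vshift k '' E)ᶜ (vshift k w) =
      vshift k '' connectedComponentIn Eᶜ w := by
    rw [← image_compl_eq (vshift k).bijective]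
    exact ((vshift k).toHomeomorph.image_connectedComponentIn hw).symm
  rw [himg, UnbBelow, UnbBelow, not_iff_not, image_image]
  constructor
  · rintro ⟨b, hb⟩
    refine ⟨b - k, ?_⟩
    rintro _ ⟨v, hv, rfl⟩
    have := hb ⟨v, hv, rfl⟩
    simp only [vshift_apply] at this
    linarith
  · rintro ⟨b, hb⟩
    refine ⟨b + k, ?_⟩
    rintro _ ⟨v, hv, rfl⟩
    have := hb ⟨v, hv, rfl⟩
    simp only [vshift_apply]
    linarith

namespace IsSeparating

theorem vshift {E : Set 𝔸} (hE : IsSeparating E) (k : ℝ) : IsSeparating (vshift k '' E) := by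
  refine ⟨hE.isCompact.image (_root_.vshift k).continuous,
    hE.isConnected.image _ (_root_.vshift k).continuous.continuousOn, ?_⟩
  rw [Uminus_image_vshift]
  obtain ⟨b, hb⟩ := hE.bddAbove
  refine ⟨b + k, ?_⟩
  rintro _ ⟨_, ⟨v, hv, rfl⟩, rfl⟩
  have := hb ⟨v, hv, rfl⟩
  simp only [vshift_apply]
  linarith

variable {C D : Set 𝔸}

theorem not_subset_of_subset (hC : IsSeparating C) (hD : IsSeparating D) (h₁ : C ⊆ Uminus D) :
    ¬ D ⊆ Uminus C := by
  intro h₂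
  have hclosed : IsClosed (Uminus C ∪ Uminus D) := by
    refine isClosed_of_closure_subset ?_
    rw [closure_union]
    refine union_subset ((closure_Uminus_subset hC.isCompact.isClosed).trans ?_)
      ((closure_Uminus_subset hD.isCompact.isClosed).trans ?_)
    · exact union_subset_union_right _ h₁
    · exact union_subset subset_union_right (h₂.trans subset_union_left)
  have hopen : IsOpen (Uminus C ∪ Uminus D) :=
    (isOpen_Uminus hC.isCompact.isClosed).union (isOpen_Uminus hD.isCompact.isClosed)
  have huniv := IsClopen.eq_univ ⟨hclosed, hopen⟩
    (hC.isConnected.nonempty.mono (h₁.trans subset_union_right))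
  obtain ⟨b, hb⟩ := hC.bddAbove
  obtain ⟨c, hc⟩ := hD.bddAbove
  have hmem : ((0 : 𝕊), max b c + 1) ∈ Uminus C ∪ Uminus D := huniv ▸ mem_univ _
  rcases hmem with h | h
  · have : max b c + 1 ≤ b := hb ⟨_, h, rfl⟩
    linarith [le_max_left b c]
  · have : max b c + 1 ≤ c := hc ⟨_, h, rfl⟩
    linarith [le_max_right b c]

theorem exists_mem_Uminus_inter (hC : IsSeparating C) (hD : IsSeparating D) :
    (Uminus C ∩ Uminus D).Nonempty := by
  obtain ⟨m, hm⟩ := (hC.isCompact.union hD.isCompact).exists_forall_le_snd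
  exact ⟨((0 : 𝕊), m - 1),
    Iio_subset_Uminus (fun z hz => hm z (Or.inl hz)) (sub_one_lt m),
    Iio_subset_Uminus (fun z hz => hm z (Or.inr hz)) (sub_one_lt m)⟩

theorem Uminus_subset_of_disjoint (hC : IsSeparating C) (hD : IsSeparating D)
    (h : Disjoint D (Uminus C)) : Uminus C ⊆ Uminus D :=
  (isPreconnected_Uminus hC.isCompact).subset_Uminus h.symm (hC.exists_mem_Uminus_inter hD)

theorem subset_or_subset (hC : IsSeparating C) (hD : IsSeparating D) (h : Disjoint C D) :
    C ⊆ Uminus D ∨ D ⊆ Uminus C := by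
  by_contra! hne
  have hCD : Disjoint C (Uminus D) := by
    rw [Set.disjoint_iff_inter_eq_empty, ← not_nonempty_iff_eq_empty]
    exact fun hn => hne.1 (hC.isConnected.isPreconnected.subset_Uminus h hn)
  have hDC : Disjoint D (Uminus C) := by
    rw [Set.disjoint_iff_inter_eq_empty, ← not_nonempty_iff_eq_empty]
    exact fun hn => hne.2 (hD.isConnected.isPreconnected.subset_Uminus h.symm hn)
  have heq : Uminus C = Uminus D :=
    (hC.Uminus_subset_of_disjoint hD hDC).antisymm (hD.Uminus_subset_of_disjoint hC hCD)
  have hfr : frontier (Uminus C) = ∅ := by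
    rw [← subset_empty_iff, ← h.inter_eq]
    exact subset_inter (frontier_Uminus_subset hC.isCompact.isClosed)
      (heq ▸ frontier_Uminus_subset hD.isCompact.isClosed)
  have huniv := (isClopen_iff_frontier_eq_empty.mpr hfr).eq_univ
    ((hC.exists_mem_Uminus_inter hD).mono inter_subset_left)
  obtain ⟨z, hz⟩ := hC.isConnected.nonempty
  exact Set.disjoint_left.mp (disjoint_Uminus C) hz (huniv ▸ mem_univ z)

theorem Uminus_mono (hC : IsSeparating C) (hD : IsSeparating D) (h : C ⊆ Uminus D) :
    Uminus C ⊆ Uminus D := by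
  refine hC.Uminus_subset_of_disjoint hD ?_
  rw [Set.disjoint_iff_inter_eq_empty, ← not_nonempty_iff_eq_empty]
  exact fun hn => hC.not_subset_of_subset hD h (hD.isConnected.isPreconnected.subset_Uminus
    ((disjoint_Uminus D).mono_right h) hn)

variable {A B D' : Set 𝔸}

theorem subset_Uminus_or (hC : IsSeparating C) (hD : IsSeparating D) (hA : IsPreconnected A)
    (hB : IsPreconnected B) (hAB : Disjoint A B) (hCA : C ⊆ A) (hDB : D ⊆ B) :
    A ⊆ Uminus D ∨ B ⊆ Uminus C := by
  refine (hC.subset_or_subset hD (hAB.mono hCA hDB)).imp (fun h => ?_) fun h => ?_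
  · obtain ⟨z, hz⟩ := hC.isConnected.nonempty
    exact hA.subset_Uminus (hAB.mono_right hDB) ⟨z, hCA hz, h hz⟩
  · obtain ⟨z, hz⟩ := hD.isConnected.nonempty
    exact hB.subset_Uminus (hAB.symm.mono_right hCA) ⟨z, hDB hz, h hz⟩

theorem subset_Uminus_congr (hC : IsSeparating C) (hD : IsSeparating D) (hD' : IsSeparating D')
    (hA : IsPreconnected A) (hB : IsPreconnected B) (hAB : Disjoint A B) (hCA : C ⊆ A)
    (hDB : D ⊆ B) (hDB' : D' ⊆ B) (h : A ⊆ Uminus D) : A ⊆ Uminus D' :=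
  (hC.subset_Uminus_or hD' hA hB hAB hCA hDB').resolve_right fun h' =>
    hC.not_subset_of_subset hD (hCA.trans h) (hDB.trans h')

end IsSeparating

/-! ### Convergence of the boundaries of nested open sets -/

theorem exists_forall_exists_dist_le {K : Set 𝔸} (hK : IsCompact K) {W W' C C' : ℕ → Set 𝔸}
    (hCK : ∀ n, C n ⊆ K) (hopen : ∀ n, IsOpen (W n)) (hmono : Monotone W) (hmono' : Monotone W')
    (hfr' : ∀ n, frontier (W' n) ⊆ C' n) (hdisj : ∀ n, Disjoint (C n) (W n))
    (hsub : ∀ n, C n ⊆ W (n + 1)) (hWW' : ∀ n, W n ⊆ W' (n + 1))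
    (hW'W : ∀ n, W' n ⊆ W (n + 1)) {δ : ℝ} (hδ : 0 < δ) :
    ∀ᶠ n in atTop, ∀ z ∈ C n, ∃ w ∈ C' n, dist z w ≤ δ := by
  by_contra hcon
  obtain ⟨φ, hφ, hbad⟩ := extraction_of_frequently_atTop (not_eventually.mp hcon)
  push Not at hbad
  choose z hzC hz using hbad
  obtain ⟨x, -, ψ, hψ, hlim⟩ := hK.tendsto_subseq fun n => hCK _ (hzC n)
  have hnotW : ∀ m, x ∉ W m := by
    intro m hm
    obtain ⟨n, hn₁, hn₂⟩ := ((hlim.eventually ((hopen m).mem_nhds hm)).and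
      ((hφ.comp hψ).tendsto_atTop.eventually_ge_atTop m)).exists
    exact Set.disjoint_left.mp (hdisj _) (hzC (ψ n)) (hmono hn₂ hn₁)
  have hnear : ∀ᶠ n in atTop, dist (z (ψ n)) x < δ / 2 :=
    hlim.eventually (ball_mem_nhds x (half_pos hδ))
  obtain ⟨k, hk⟩ := hnear.exists
  obtain ⟨n, hn₁, hn₂⟩ := (hnear.and
    ((hφ.comp hψ).tendsto_atTop.eventually_ge_atTop (φ (ψ k) + 2))).exists
  have hin : z (ψ k) ∈ W' (φ (ψ n)) := hmono' hn₂ (hWW' _ (hsub _ (hzC _)))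
  obtain ⟨w, hwb, hw⟩ := (isPreconnected_ball_annulus x (δ / 2)).exists_mem_frontier
    ⟨_, hk, hin⟩ ⟨x, mem_ball_self (half_pos hδ), fun h => hnotW _ (hW'W _ h)⟩
  have h₁ := hz (ψ n) w (hfr' _ hw)
  have h₂ := dist_triangle_right (z (ψ n)) w x
  rw [mem_ball] at hwb
  linarith

theorem exists_hausdorffDist_le {K : Set 𝔸} (hK : IsCompact K) {W W' C C' : ℕ → Set 𝔸}
    (hCK : ∀ n, C n ⊆ K) (hCK' : ∀ n, C' n ⊆ K) (hopen : ∀ n, IsOpen (W n))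
    (hopen' : ∀ n, IsOpen (W' n)) (hmono : Monotone W) (hmono' : Monotone W')
    (hfr : ∀ n, frontier (W n) ⊆ C n) (hfr' : ∀ n, frontier (W' n) ⊆ C' n)
    (hdisj : ∀ n, Disjoint (C n) (W n)) (hdisj' : ∀ n, Disjoint (C' n) (W' n))
    (hsub : ∀ n, C n ⊆ W (n + 1)) (hsub' : ∀ n, C' n ⊆ W' (n + 1))
    (hWW' : ∀ n, W n ⊆ W' (n + 1)) (hW'W : ∀ n, W' n ⊆ W (n + 1)) {δ : ℝ} (hδ : 0 < δ) :
    ∃ n, hausdorffDist (C n) (C' n) ≤ δ := by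
  obtain ⟨n, h₁, h₂⟩ := ((exists_forall_exists_dist_le hK hCK hopen hmono hmono' hfr' hdisj hsub
    hWW' hW'W hδ).and (exists_forall_exists_dist_le hK hCK' hopen' hmono' hmono hfr hdisj' hsub'
    hW'W hWW' hδ)).exists
  exact ⟨n, hausdorffDist_le_of_mem_dist hδ.le h₁ h₂⟩

theorem exists_hausdorffDist_le_of_increasing {K : Set 𝔸} (hK : IsCompact K) {C C' : ℕ → Set 𝔸}
    (hCK : ∀ n, C n ⊆ K) (hCK' : ∀ n, C' n ⊆ K) (hC : ∀ n, IsSeparating (C n))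
    (hC' : ∀ n, IsSeparating (C' n))
    (h : ∀ n, C n ∪ C' n ⊆ Uminus (C (n + 1)) ∩ Uminus (C' (n + 1))) {δ : ℝ} (hδ : 0 < δ) :
    ∃ n, hausdorffDist (C n) (C' n) ≤ δ := by
  have h₁ : ∀ n, C n ⊆ Uminus (C (n + 1)) := fun n z hz => (h n (Or.inl hz)).1
  have h₂ : ∀ n, C n ⊆ Uminus (C' (n + 1)) := fun n z hz => (h n (Or.inl hz)).2
  have h₃ : ∀ n, C' n ⊆ Uminus (C (n + 1)) := fun n z hz => (h n (Or.inr hz)).1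
  have h₄ : ∀ n, C' n ⊆ Uminus (C' (n + 1)) := fun n z hz => (h n (Or.inr hz)).2
  exact exists_hausdorffDist_le hK hCK hCK'
    (fun n => isOpen_Uminus (hC n).isCompact.isClosed)
    (fun n => isOpen_Uminus (hC' n).isCompact.isClosed)
    (monotone_nat_of_le_succ fun n => (hC n).Uminus_mono (hC _) (h₁ n))
    (monotone_nat_of_le_succ fun n => (hC' n).Uminus_mono (hC' _) (h₄ n))
    (fun n => frontier_Uminus_subset (hC n).isCompact.isClosed)
    (fun n => frontier_Uminus_subset (hC' n).isCompact.isClosed)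
    (fun n => disjoint_Uminus _) (fun n => disjoint_Uminus _) h₁ h₄
    (fun n => (hC n).Uminus_mono (hC' _) (h₂ n)) (fun n => (hC' n).Uminus_mono (hC _) (h₃ n)) hδ

theorem frontier_compl_Uminus_union_subset {E : Set 𝔸} (hE : IsClosed E) :
    frontier (Uminus E ∪ E)ᶜ ⊆ E := by
  rw [frontier_compl, (isClosed_Uminus_union hE).frontier_eq]
  exact fun z hz => hz.1.resolve_left fun h =>
    hz.2 (interior_maximal subset_union_left (isOpen_Uminus hE) h)

namespace IsSeparating

variable {C D : Set 𝔸}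

theorem compl_subset_compl (hC : IsSeparating C) (hD : IsSeparating D) (h : D ⊆ Uminus C) :
    (Uminus C ∪ C)ᶜ ⊆ (Uminus D ∪ D)ᶜ :=
  Set.compl_subset_compl.mpr
    ((union_subset (hD.Uminus_mono hC h) h).trans subset_union_left)

theorem subset_compl (hC : IsSeparating C) (hD : IsSeparating D) (h : D ⊆ Uminus C) :
    C ⊆ (Uminus D ∪ D)ᶜ :=
  ((disjoint_Uminus C).mono_right (union_subset (hD.Uminus_mono hC h) h)).subset_compl_right

end IsSeparating

theorem exists_hausdorffDist_le_of_decreasing {K : Set 𝔸} (hK : IsCompact K) {C C' : ℕ → Set 𝔸}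
    (hCK : ∀ n, C n ⊆ K) (hCK' : ∀ n, C' n ⊆ K) (hC : ∀ n, IsSeparating (C n))
    (hC' : ∀ n, IsSeparating (C' n))
    (h : ∀ n, C (n + 1) ∪ C' (n + 1) ⊆ Uminus (C n) ∩ Uminus (C' n)) {δ : ℝ} (hδ : 0 < δ) :
    ∃ n, hausdorffDist (C n) (C' n) ≤ δ := by
  have h₁ : ∀ n, C (n + 1) ⊆ Uminus (C n) := fun n z hz => (h n (Or.inl hz)).1
  have h₂ : ∀ n, C (n + 1) ⊆ Uminus (C' n) := fun n z hz => (h n (Or.inl hz)).2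
  have h₃ : ∀ n, C' (n + 1) ⊆ Uminus (C n) := fun n z hz => (h n (Or.inr hz)).1
  have h₄ : ∀ n, C' (n + 1) ⊆ Uminus (C' n) := fun n z hz => (h n (Or.inr hz)).2
  exact exists_hausdorffDist_le hK hCK hCK'
    (fun n => (isClosed_Uminus_union (hC n).isCompact.isClosed).isOpen_compl)
    (fun n => (isClosed_Uminus_union (hC' n).isCompact.isClosed).isOpen_compl)
    (monotone_nat_of_le_succ fun n => (hC n).compl_subset_compl (hC _) (h₁ n))
    (monotone_nat_of_le_succ fun n => (hC' n).compl_subset_compl (hC' _) (h₄ n))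
    (fun n => frontier_compl_Uminus_union_subset (hC n).isCompact.isClosed)
    (fun n => frontier_compl_Uminus_union_subset (hC' n).isCompact.isClosed)
    (fun n => Set.disjoint_left.mpr fun z hz hz' => hz' (Or.inr hz))
    (fun n => Set.disjoint_left.mpr fun z hz hz' => hz' (Or.inr hz))
    (fun n => (hC n).subset_compl (hC _) (h₁ n)) (fun n => (hC' n).subset_compl (hC' _) (h₄ n))
    (fun n => (hC n).compl_subset_compl (hC' _) (h₃ n))
    (fun n => (hC' n).compl_subset_compl (hC _) (h₂ n)) hδ

/-- In a sequence of pairwise disjoint connected subsets of a compact part of the annulus, any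
choice of pairs of separating continua becomes arbitrarily narrow. -/
theorem exists_hausdorffDist_le_of_pairwise_disjoint {K : Set 𝔸} (hK : IsCompact K)
    {A C C' : ℕ → Set 𝔸} (hA : ∀ n, IsPreconnected (A n)) (hAK : ∀ n, A n ⊆ K)
    (hdisj : Pairwise (Disjoint on A)) (hC : ∀ n, IsSeparating (C n))
    (hC' : ∀ n, IsSeparating (C' n)) (hCA : ∀ n, C n ⊆ A n) (hCA' : ∀ n, C' n ⊆ A n)
    {δ : ℝ} (hδ : 0 < δ) : ∃ n, hausdorffDist (C n) (C' n) ≤ δ := by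
  have hcongr : ∀ m n, m ≠ n → A m ⊆ Uminus (C n) → A m ⊆ Uminus (C n) ∩ Uminus (C' n) :=
    fun m n hmn h => subset_inter h ((hC m).subset_Uminus_congr (hC n) (hC' n) (hA m) (hA n)
      (hdisj hmn) (hCA m) (hCA n) (hCA' n) h)
  let r : ℕ → ℕ → Prop := fun m n => A m ⊆ Uminus (C n)
  have : IsTrans ℕ r := ⟨fun i j k hij hjk =>
    hij.trans ((hC j).Uminus_mono (hC k) ((hCA j).trans hjk))⟩
  obtain ⟨g, hg | hg⟩ := exists_increasing_or_nonincreasing_subseq r id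
  · obtain ⟨n, hn⟩ := exists_hausdorffDist_le_of_increasing hK (C := C ∘ g) (C' := C' ∘ g)
      (fun n => (hCA _).trans (hAK _)) (fun n => (hCA' _).trans (hAK _)) (fun n => hC _)
      (fun n => hC' _) (fun n => (union_subset (hCA _) (hCA' _)).trans
        (hcongr _ _ (g.injective.ne n.succ_ne_self.symm) (hg _ _ n.lt_succ_self))) hδ
    exact ⟨_, hn⟩
  · obtain ⟨n, hn⟩ := exists_hausdorffDist_le_of_decreasing hK (C := C ∘ g) (C' := C' ∘ g)
      (fun n => (hCA _).trans (hAK _)) (fun n => (hCA' _).trans (hAK _)) (fun n => hC _)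
      (fun n => hC' _) (fun n => (union_subset (hCA _) (hCA' _)).trans
        (hcongr _ _ (g.injective.ne n.succ_ne_self)
          (((hC _).subset_Uminus_or (hC _) (hA _) (hA _)
            (hdisj (g.injective.ne n.succ_ne_self.symm)) (hCA _) (hCA _)).resolve_left
              (hg _ _ n.lt_succ_self)))) hδ
    exact ⟨_, hn⟩

/-! ### Wide fibers -/

theorem exists_wide_pair {P : 𝔸 → Prop} (hP : ∀ (k : ℤ) z, P z → P (vshift k z)) {z : 𝔸} {ε : ℝ}
    (hε : 0 < ε) (hz : ε ≤ uw (connectedComponentIn {w | P w} z)) :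
    ∃ A C C' : Set 𝔸, IsPreconnected A ∧ (∀ w ∈ A, P w) ∧ IsSeparating C ∧ IsSeparating C' ∧
      C ⊆ A ∧ C' ⊆ A ∧ ε / 2 < hausdorffDist C C' ∧ ∃ w ∈ C, w.2 ∈ Icc (0 : ℝ) 1 := by
  obtain ⟨C, C', hC, hC', hCA, hCA', hd⟩ : ∃ C C' : Set 𝔸, IsEssentialContinuum C ∧
      IsEssentialContinuum C' ∧ C ⊆ connectedComponentIn {w | P w} z ∧
      C' ⊆ connectedComponentIn {w | P w} z ∧ ε / 2 < hausdorffDist C C' := by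
    by_contra! hcon
    have : uw (connectedComponentIn {w | P w} z) ≤ ε / 2 := by
      refine Real.sSup_le ?_ (half_pos hε).le
      rintro _ ⟨C, C', hC, hC', hCA, hCA', rfl⟩
      exact hcon C C' hC hC' hCA hCA'
    linarith
  obtain ⟨w, hw⟩ := hC.2.1.nonempty
  refine ⟨vshift (-⌊w.2⌋ : ℤ) '' connectedComponentIn {w | P w} z, vshift (-⌊w.2⌋ : ℤ) '' C,
    vshift (-⌊w.2⌋ : ℤ) '' C',
    isPreconnected_connectedComponentIn.image _ (vshift _).continuous.continuousOn, ?_,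
    hC.isSeparating.vshift _, hC'.isSeparating.vshift _, image_mono hCA, image_mono hCA', ?_,
    _, mem_image_of_mem _ hw, ?_⟩
  · rintro _ ⟨v, hv, rfl⟩
    exact hP _ _ (connectedComponentIn_subset _ _ hv)
  · rwa [hausdorffDist_image (vshift _).isometry]
  · rw [vshift_apply]
    push_cast
    exact ⟨by linarith [Int.floor_le w.2], by linarith [Int.lt_floor_add_one w.2]⟩

/-- Connected sets which meet a fixed horizontal strip and avoid all vertical integer translates
of a separating continuum are uniformly bounded. -/
theorem IsSeparating.exists_isCompact {C : Set 𝔸} (hC : IsSeparating C) :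
    ∃ K : Set 𝔸, IsCompact K ∧ ∀ A : Set 𝔸, IsPreconnected A →
      (∀ k : ℤ, Disjoint A (_root_.vshift k '' C)) → (∃ w ∈ A, w.2 ∈ Icc (0 : ℝ) 1) → A ⊆ K := by
  obtain ⟨m, hm⟩ := hC.isCompact.exists_forall_le_snd
  obtain ⟨b, hb⟩ := hC.bddAbove
  obtain ⟨k, hk⟩ := exists_int_gt (1 - m)
  obtain ⟨l, hl⟩ := exists_int_lt (-b)
  refine ⟨univ ×ˢ Icc (m + l) (b + k), isCompact_univ.prod isCompact_Icc, ?_⟩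
  rintro A hA hdisj ⟨w, hwA, hw⟩
  have hup : A ⊆ Uminus (_root_.vshift k '' C) := by
    refine hA.subset_Uminus (hdisj k) ⟨w, hwA, ?_⟩
    refine Iio_subset_Uminus (m := m + k) ?_ (show w.2 < m + k by linarith [hw.2])
    rintro _ ⟨v, hv, rfl⟩
    simpa using hm v hv
  have hdown : Disjoint A (Uminus (_root_.vshift l '' C)) := by
    rw [Set.disjoint_iff_inter_eq_empty, ← not_nonempty_iff_eq_empty]
    intro hn
    have hwm := hA.subset_Uminus (hdisj l) hn hwA
    rw [Uminus_image_vshift] at hwm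
    obtain ⟨v, hv, rfl⟩ := hwm
    have h₁ : v.2 ≤ b := hb ⟨v, hv, rfl⟩
    have h₂ := hw.1
    rw [vshift_apply] at h₂
    simp only at h₂
    linarith
  intro z hz
  refine ⟨trivial, ?_, ?_⟩
  · by_contra! hlt
    refine Set.disjoint_left.mp hdown hz (Iio_subset_Uminus (m := m + l) ?_ hlt)
    rintro _ ⟨v, hv, rfl⟩
    simpa using hm v hv
  · have hzm := hup hz
    rw [Uminus_image_vshift] at hzm
    obtain ⟨v, hv, rfl⟩ := hzm
    have : v.2 ≤ b := hb ⟨v, hv, rfl⟩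
    simpa using this

theorem finitely_many_wide_fibers
    (h : 𝕋2 → 𝕊) (hh : IsHorizontalMap h) :
    ∀ ε > (0:ℝ),
      {t : 𝕊 | ∃ z ∈ θ ⁻¹' (h ⁻¹' {t}),
        ε ≤ uw (connectedComponentIn (θ ⁻¹' (h ⁻¹' {t})) z)}.Finite := by
  intro ε hε
  by_contra hinf
  have hpair : ∀ t ∈ {t : 𝕊 | ∃ z ∈ θ ⁻¹' (h ⁻¹' {t}),
      ε ≤ uw (connectedComponentIn (θ ⁻¹' (h ⁻¹' {t})) z)}, _ := fun t ⟨z, _, hz⟩ =>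
    exists_wide_pair (P := fun w => h (θ w) = t) (fun k w hw => by rwa [θ_vshift]) hε hz
  have f := Set.Infinite.natEmbedding _ hinf
  choose A C C' hA hAP hC hC' hCA hCA' hd hstrip using fun n => hpair (f n) (f n).2
  obtain ⟨K, hK, hKA⟩ := (hC 0).exists_isCompact
  have hne : ∀ m n, m ≠ n → ((f m : 𝕊)) ≠ f n := fun m n hmn heq =>
    hmn (f.injective (Subtype.ext heq))
  have hAK : ∀ n, A (n + 1) ⊆ K := by
    intro n
    refine hKA _ (hA _) (fun k => Set.disjoint_left.mpr ?_) ?_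
    · rintro _ hv ⟨v, hvC, rfl⟩
      have h₁ := hAP _ _ hv
      rw [θ_vshift, hAP _ _ (hCA _ hvC)] at h₁
      exact hne _ _ n.succ_ne_zero.symm h₁
    · obtain ⟨w, hw, hw'⟩ := hstrip (n + 1)
      exact ⟨w, hCA _ hw, hw'⟩
  have hdisj : Pairwise (Disjoint on fun n => A (n + 1)) := by
    intro i j hij
    refine Set.disjoint_left.mpr fun v hv hv' => ?_
    exact hne (i + 1) (j + 1) (by simpa using hij) ((hAP _ _ hv).symm.trans (hAP _ _ hv'))
  obtain ⟨n, hn⟩ := exists_hausdorffDist_le_of_pairwise_disjoint hK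
    (fun n => hA (n + 1)) hAK hdisj (fun n => hC _) (fun n => hC' _)
    (fun n => hCA _) (fun n => hCA' _) (half_pos hε)
  exact (hd (n + 1)).not_ge hn
end
end

section
/- Let f be a horizontal extension of an irrational rotation of 𝕋², with horizontal map h satisfying h∘f = R∘h for an irrational rotation R of S¹. Given ε > 0 and δ > 0, there exists η > 0 such that for every closed interval I ⊂ S¹ of length smaller than η, setting A = h⁻¹(I), the set { n ∈ ℕ : uw(fⁿ(A)) < ε } has lower density at least 1 − δ. -/
/- STATEMENT 6: For a horizontal extension `f` of an irrational rotation with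
`h ∘ f = R ∘ h`, and any `ε, δ > 0`, there is `η > 0` such that for any closed
interval `I ⊆ S¹` of length `< η`, the set of `n` with `uw(fⁿ(h⁻¹(I))) < ε`
has lower density at least `1 − δ`.  A closed interval of `S¹` of length `< η`
is the image of `[a,b] ⊆ ℝ` with `b − a < η`; the upper width of `fⁿ(A)` is
that of any connected component of its `θ`-preimage (we require it for all
components, which all have the same width). -/

noncomputable section
open Set Metric Filter Topology Function

lemma exists_int_add_of_coe_eq {a b : ℝ} (hab : (a : 𝕊) = b) : ∃ d : ℤ, a = b + d := by
  obtain ⟨d, hd⟩ := AddSubgroup.mem_zmultiples_iff.1 ((QuotientAddGroup.eq (s := AddSubgroup.zmultiples (1:ℝ))).1 hab.symm)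
  refine ⟨d, ?_⟩
  simp only [zsmul_eq_mul, mul_one] at hd
  linarith

lemma coe_add_int (a : ℝ) (d : ℤ) : ((a + d : ℝ) : 𝕊) = a := by
  simp

/-- Two real lifts of the same circle-valued map differ by an integer constant. -/
lemma exists_int_forall_eq_add {X : Type*} [TopologicalSpace X] {S : Set X}
    (hS : IsPreconnected S) {A B : X → ℝ} (hA : ContinuousOn A S) (hB : ContinuousOn B S)
    (hAB : ∀ x ∈ S, (A x : 𝕊) = B x) : ∃ d : ℤ, ∀ x ∈ S, A x = B x + d := by
  rcases S.eq_empty_or_nonempty with rfl | ⟨x₀, hx₀⟩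
  · exact ⟨0, by simp⟩
  obtain ⟨d, hd⟩ := exists_int_add_of_coe_eq (hAB x₀ hx₀)
  refine ⟨d, fun x hx => ?_⟩
  have : DiscreteTopology (range ((↑) : ℤ → ℝ)) :=
    Int.isClosedEmbedding_coe_real.toIsEmbedding.toHomeomorph.symm.isEmbedding.discreteTopology
  have hmaps : MapsTo (fun x => A x - B x) S (range ((↑) : ℤ → ℝ)) := by
    intro y hy
    obtain ⟨e, he⟩ := exists_int_add_of_coe_eq (hAB y hy)
    exact ⟨e, by simp only [he]; ring⟩
  have := hS.constant_of_mapsTo ⟨this⟩ (hA.sub hB) hmaps hx hx₀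
  simp only [Pi.sub_apply] at this
  linarith

lemma exists_lift_real {g : ℝ × ℝ → 𝕊} (hg : Continuous g) :
    ∃ G : ℝ × ℝ → ℝ, Continuous G ∧ ∀ p, (G p : 𝕊) = g p := by
  obtain ⟨e, he⟩ := QuotientAddGroup.mk_surjective (g 0)
  obtain ⟨F, hF, -⟩ := (AddCircle.isCoveringMap_coe (1:ℝ)).existsUnique_continuousMap_lifts
    ⟨g, hg⟩ 0 e he
  exact ⟨F, F.continuous, fun p => congrFun hF.2 p⟩

lemma isOpenQuotientMap_coe : IsOpenQuotientMap ((↑) : ℝ → 𝕊) :=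
  QuotientAddGroup.isOpenQuotientMap_mk

lemma isOpenQuotientMap_τ : IsOpenQuotientMap τ :=
  isOpenQuotientMap_coe.prodMap IsOpenQuotientMap.id

lemma isOpenQuotientMap_θ : IsOpenQuotientMap θ :=
  IsOpenQuotientMap.id.prodMap isOpenQuotientMap_coe

/-- A continuous function on `ℝ²` invariant under horizontal translation descends to `𝔸`. -/
lemma exists_descend_τ {G : ℝ × ℝ → ℝ} (hG : Continuous G)
    (hper : ∀ x y, G (x + 1, y) = G (x, y)) :
    ∃ H : 𝔸 → ℝ, Continuous H ∧ ∀ p, H (τ p) = G p := by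
  have hinv : ∀ p q, τ p = τ q → G p = G q := by
    rintro ⟨x, y⟩ ⟨x', y'⟩ hpq
    simp only [τ, Prod.mk.injEq] at hpq
    obtain ⟨h1, rfl⟩ := hpq
    obtain ⟨d, rfl⟩ := exists_int_add_of_coe_eq h1
    have hp : Function.Periodic (fun x => G (x, y)) 1 := fun x => hper x y
    simpa using hp.int_mul d x'
  have key : ∀ p, G (Function.surjInv isOpenQuotientMap_τ.surjective (τ p)) = G p := fun p =>
    hinv _ _ (Function.surjInv_eq isOpenQuotientMap_τ.surjective (τ p))
  refine ⟨fun z => G (Function.surjInv isOpenQuotientMap_τ.surjective z), ?_, key⟩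
  rw [← isOpenQuotientMap_τ.continuous_comp_iff]
  exact hG.congr fun p => (key p).symm

/-- A continuous function on `𝔸` invariant under vertical translation descends to `𝕋2`. -/
lemma exists_descend_θ {G : 𝔸 → ℝ} (hG : Continuous G)
    (hper : ∀ u y, G (u, y + 1) = G (u, y)) :
    ∃ H : 𝕋2 → ℝ, Continuous H ∧ ∀ p, H (θ p) = G p := by
  have hinv : ∀ p q, θ p = θ q → G p = G q := by
    rintro ⟨x, y⟩ ⟨x', y'⟩ hpq
    simp only [θ, Prod.mk.injEq] at hpq
    obtain ⟨rfl, h1⟩ := hpq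
    obtain ⟨d, rfl⟩ := exists_int_add_of_coe_eq h1
    have hp : Function.Periodic (fun y => G (x, y)) 1 := fun y => hper x y
    simpa using hp.int_mul d y'
  have key : ∀ p, G (Function.surjInv isOpenQuotientMap_θ.surjective (θ p)) = G p := fun p =>
    hinv _ _ (Function.surjInv_eq isOpenQuotientMap_θ.surjective (θ p))
  refine ⟨fun z => G (Function.surjInv isOpenQuotientMap_θ.surjective z), ?_, key⟩
  rw [← isOpenQuotientMap_θ.continuous_comp_iff]
  exact hG.congr fun p => (key p).symm

instance : LocallyConnectedSpace 𝔸 :=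
  isOpenQuotientMap_τ.isQuotientMap.isCoinducing.locallyConnectedSpace

/-- An essential annular continuum splits the annulus into an upper and a lower open set. -/
lemma IsEssentialAnnularContinuum.exists_split {C : Set 𝔸} (hC : IsEssentialAnnularContinuum C) :
    ∃ (U V : Set 𝔸) (Y : ℝ), IsOpen U ∧ IsOpen V ∧ Disjoint U V ∧ Cᶜ ⊆ U ∪ V ∧
      (∀ z : 𝔸, Y < z.2 → z ∈ U) ∧ (∀ z : 𝔸, z.2 < -Y → z ∈ V) := by
  obtain ⟨hcpt, -, U, V, ⟨u, hu, rfl⟩, ⟨v, hv, rfl⟩, hne, hU, hV, hall⟩ := hC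
  obtain ⟨a, ha⟩ := (hcpt.image continuous_snd).bddAbove
  obtain ⟨b, hb⟩ := (hcpt.image continuous_snd).bddBelow
  have hopen : IsOpen Cᶜ := hcpt.isClosed.isOpen_compl
  refine ⟨connectedComponentIn Cᶜ u, connectedComponentIn Cᶜ v, max a (-b), hopen.connectedComponentIn, hopen.connectedComponentIn, ?_, ?_, ?_, ?_⟩
  · rw [Set.disjoint_left]
    intro z hz hz'
    exact hne ((connectedComponentIn_eq hz).trans (connectedComponentIn_eq hz').symm)
  · intro z hz
    have hmem := mem_connectedComponentIn hz
    rcases hall _ ⟨z, hz, rfl⟩ with h | h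
    · exact Or.inl (h ▸ hmem)
    · exact Or.inr (h ▸ hmem)
  · intro z hz
    have hpre : IsPreconnected ((univ : Set 𝕊) ×ˢ Ioi (max a (-b))) :=
      isPreconnected_univ.prod isPreconnected_Ioi
    have hsub : (univ : Set 𝕊) ×ˢ Ioi (max a (-b)) ⊆ Cᶜ := by
      rintro w ⟨-, hw⟩ hwC
      have := ha ⟨w, hwC, rfl⟩
      exact absurd (lt_of_le_of_lt (le_max_left _ _) hw) (not_lt.2 this)
    obtain ⟨_, ⟨w, hw, rfl⟩, hwY⟩ := not_bddAbove_iff.1 hU (max a (-b))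
    rw [connectedComponentIn_eq hw]
    exact hpre.subset_connectedComponentIn ⟨mem_univ _, hwY⟩ hsub ⟨mem_univ _, hz⟩
  · intro z hz
    have hpre : IsPreconnected ((univ : Set 𝕊) ×ˢ Iio (-max a (-b))) :=
      isPreconnected_univ.prod isPreconnected_Iio
    have hsub : (univ : Set 𝕊) ×ˢ Iio (-max a (-b)) ⊆ Cᶜ := by
      rintro w ⟨-, hw⟩ hwC
      have h1 := hb ⟨w, hwC, rfl⟩
      have h2 := le_max_right a (-b)
      simp only [mem_Iio] at hw
      linarith
    obtain ⟨_, ⟨w, hw, rfl⟩, hwY⟩ := not_bddBelow_iff.1 hV (-max a (-b))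
    rw [connectedComponentIn_eq hw]
    exact hpre.subset_connectedComponentIn ⟨mem_univ _, hwY⟩ hsub ⟨mem_univ _, hz⟩

/-- A circle-valued map vanishing on an essential annular continuum has horizontal degree zero. -/
lemma degree_eq_zero {C : Set 𝔸} (hC : IsEssentialAnnularContinuum C) {g : 𝔸 → 𝕊}
    (hg : Continuous g) (hg0 : ∀ z ∈ C, g z = 0) {G : ℝ × ℝ → ℝ} (hG : Continuous G)
    (hGg : ∀ p, (G p : 𝕊) = g (τ p)) {m : ℤ} (hm : ∀ x y, G (x + 1, y) = G (x, y) + m) :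
    m = 0 := by
  classical
  obtain ⟨U, V, Y, hU, hV, hdisj, hcov, hup, hlow⟩ := hC.exists_split
  have hq : Continuous fun z => if z ∈ U then g z else 0 := by
    refine Continuous.if (fun a ha => ?_) hg continuous_const
    refine hg0 a (by_contra fun haC => ?_)
    rcases hcov haC with h | h
    · exact ha.2 (hU.interior_eq.symm ▸ h)
    · obtain ⟨w, hw, hw'⟩ := mem_closure_iff.1 ha.1 V hV h
      exact Set.disjoint_left.1 hdisj hw' hw
  obtain ⟨Q, hQ, hQq⟩ := exists_lift_real (hq.comp isOpenQuotientMap_τ.continuous)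
  obtain ⟨d, hd⟩ := exists_int_forall_eq_add (S := univ) isPreconnected_univ
    (A := fun p : ℝ × ℝ => Q (p.1 + 1, p.2)) (B := Q) (by fun_prop) (by fun_prop) (by
      rintro ⟨x, y⟩ -
      have hτ : τ (x + 1, y) = τ (x, y) := by simp [τ]
      simp only [hQq, Function.comp_apply, hτ])
  obtain ⟨e, he⟩ := exists_int_forall_eq_add (S := (univ : Set ℝ) ×ˢ Ioi Y)
    (isPreconnected_univ.prod isPreconnected_Ioi)
    (A := Q) (B := G) (by fun_prop) (by fun_prop) (by
      rintro p ⟨-, hp⟩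
      rw [hQq, hGg, Function.comp_apply, if_pos (hup (τ p) hp)])
  obtain ⟨e', he'⟩ := exists_int_forall_eq_add (S := (univ : Set ℝ) ×ˢ Iio (-Y))
    (isPreconnected_univ.prod isPreconnected_Iio)
    (A := Q) (B := fun _ => 0) (by fun_prop) (by fun_prop) (by
      rintro p ⟨-, hp⟩
      rw [hQq, Function.comp_apply, if_neg (Set.disjoint_right.1 hdisj (hlow (τ p) hp))]
      simp)
  have h1 := hd (0, Y + 1) trivial
  have h2 := hd (0, -Y - 1) trivial
  have h3 := he (0 + 1, Y + 1) ⟨trivial, by simp⟩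
  have h4 := he (0, Y + 1) ⟨trivial, by simp⟩
  have h5 := he' (0 + 1, -Y - 1) ⟨trivial, by simp⟩
  have h6 := he' (0, -Y - 1) ⟨trivial, by simp⟩
  have h7 := hm 0 (Y + 1)
  simp only at h1 h2
  have : (m : ℝ) = 0 := by linarith
  exact_mod_cast this

lemma isPreconnected_fiber {h : 𝕋2 → 𝕊} (hh : IsHorizontalMap h) (t : 𝕊) :
    IsPreconnected (h ⁻¹' {t}) :=
  (hh.2.2 t).2.1.isPreconnected

/-- A horizontal map cannot be lifted to a real-valued map on the torus. -/
lemma IsHorizontalMap.not_exists_lift {h : 𝕋2 → 𝕊} (hh : IsHorizontalMap h) {g : 𝕋2 → ℝ}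
    (hg : Continuous g) (hgh : ∀ q, (g q : 𝕊) = h q) : False := by
  have hconst : ∀ q q', h q = h q' → g q = g q' := by
    intro q q' hqq
    obtain ⟨d, hd⟩ := exists_int_forall_eq_add (isPreconnected_fiber hh (h q))
      (A := g) (B := fun _ => g q) hg.continuousOn continuousOn_const (by
        intro x hx
        rw [hgh, hgh]
        exact hx)
    have h1 := hd q rfl
    have h2 := hd q' hqq.symm
    linarith
  obtain ⟨p, -, hp⟩ := isCompact_univ.exists_isMinOn univ_nonempty hg.continuousOn
  obtain ⟨P, -, hP⟩ := isCompact_univ.exists_isMaxOn univ_nonempty hg.continuousOn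
  have hlt : g P < g p + 1 := by
    by_contra! hle
    obtain ⟨q, hq⟩ := mem_range_of_exists_le_of_exists_ge hg
      ⟨p, (by linarith : g p ≤ g p + 1)⟩ ⟨P, hle⟩
    have : g q = g p := hconst _ _ (by rw [← hgh, ← hgh, hq]; simp)
    linarith
  obtain ⟨q, hq⟩ := hh.2.1 (((g P + (g p + 1)) / 2 : ℝ) : 𝕊)
  rw [← hgh] at hq
  obtain ⟨d, hd⟩ := exists_int_add_of_coe_eq hq
  have h1 : g p ≤ g q := hp (mem_univ q)
  have h2 : g q ≤ g P := hP (mem_univ q)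
  have h3 : (d : ℝ) < 0 := by linarith
  have h4 : (-1 : ℝ) < d := by linarith
  have h3' : d < 0 := by exact_mod_cast h3
  have h4' : -1 < d := by exact_mod_cast h4
  omega

/-- A horizontal map lifts to a real-valued map of the annulus, of nonzero vertical degree. -/
lemma IsHorizontalMap.exists_lift {h : 𝕋2 → 𝕊} (hh : IsHorizontalMap h) :
    ∃ (H : 𝔸 → ℝ) (k : ℤ), Continuous H ∧ (∀ z, (H z : 𝕊) = h (θ z)) ∧
      (∀ u y, H (u, y + 1) = H (u, y) + k) ∧ k ≠ 0 := by
  obtain ⟨G, hG, hGh⟩ := exists_lift_real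
    ((hh.1.comp isOpenQuotientMap_θ.continuous).comp isOpenQuotientMap_τ.continuous)
  obtain ⟨m, hm⟩ := exists_int_forall_eq_add (S := univ) isPreconnected_univ
    (A := fun p : ℝ × ℝ => G (p.1 + 1, p.2)) (B := G) (by fun_prop) (by fun_prop) (by
      rintro ⟨x, y⟩ -
      simp [hGh, τ])
  have hm0 : m = 0 := by
    set t : ℝ := G 0 with ht
    have hmem : (0, 0) ∈ θ ⁻¹' (h ⁻¹' {(t : 𝕊)}) := by
      simp only [mem_preimage, mem_singleton_iff, ht, hGh]
      simp [τ]
    refine degree_eq_zero ((hh.2.2 (t : 𝕊)).2.2 _ hmem) (g := fun z => h (θ z) - (t : 𝕊))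
      ((hh.1.comp isOpenQuotientMap_θ.continuous).sub continuous_const) ?_
      (G := fun p => G p - t) (by fun_prop) (fun p => by simp [hGh]) (m := m) ?_
    · intro z hz
      have hzt : z ∈ θ ⁻¹' (h ⁻¹' {(t : 𝕊)}) := connectedComponentIn_subset _ _ hz
      exact sub_eq_zero.2 hzt
    · intro x y
      have := hm (x, y) trivial
      simp only at this
      rw [this]
      ring
  subst hm0
  obtain ⟨H, hH, hHG⟩ := exists_descend_τ hG (fun x y => by simpa using hm (x, y) trivial)
  have hlift : ∀ z, (H z : 𝕊) = h (θ z) := fun z => by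
    obtain ⟨p, rfl⟩ := isOpenQuotientMap_τ.surjective z
    rw [hHG, hGh]; rfl
  obtain ⟨k, hk⟩ := exists_int_forall_eq_add (S := univ) isPreconnected_univ
    (A := fun p : 𝔸 => H (p.1, p.2 + 1)) (B := H) (by fun_prop) (by fun_prop) (by
      rintro ⟨x, y⟩ -
      simp [hlift, θ])
  refine ⟨H, k, hH, hlift, fun u y => hk (u, y) trivial, ?_⟩
  rintro rfl
  obtain ⟨g, hg, hgH⟩ := exists_descend_θ hH (fun u y => by simpa using hk (u, y) trivial)
  refine hh.not_exists_lift hg fun q => ?_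
  obtain ⟨z, rfl⟩ := isOpenQuotientMap_θ.surjective q
  rw [hgH, hlift]

lemma add_int_vertical {H : 𝔸 → ℝ} {k : ℤ} (hk : ∀ u y, H (u, y + 1) = H (u, y) + k)
    (u : 𝕊) (y : ℝ) (l : ℤ) : H (u, y + l) = H (u, y) + k * l := by
  have hp : Function.Periodic (fun y => H (u, y) - k * y) 1 := fun y => by
    simp only [hk]; ring
  have := hp.int_mul l y
  simp only [mul_one] at this
  linarith

/-- A map of nonzero vertical degree is proper. -/
lemma isProperMap_of_degree {H : 𝔸 → ℝ} (hH : Continuous H) {k : ℤ}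
    (hk : ∀ u y, H (u, y + 1) = H (u, y) + k) (hk0 : k ≠ 0) : IsProperMap H := by
  rw [isProperMap_iff_isCompact_preimage]
  refine ⟨hH, fun K hK => ?_⟩
  obtain ⟨M, hM⟩ := ((isCompact_univ (X := 𝕊)).prod (isCompact_Icc (a := (0:ℝ)) (b := 1))).exists_bound_of_continuousOn
    hH.continuousOn
  obtain ⟨R, hR⟩ := hK.exists_bound_of_continuousOn continuousOn_id
  refine ((isCompact_univ (X := 𝕊)).prod (isCompact_Icc (a := -(R + M)) (b := R + M + 1))).of_isClosed_subset
    (hK.isClosed.preimage hH) ?_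
  rintro ⟨u, y⟩ hz
  have h1 := add_int_vertical hk u (Int.fract y) ⌊y⌋
  rw [Int.fract_add_floor] at h1
  have h2 := hM (u, Int.fract y) ⟨trivial, Int.fract_nonneg y, (Int.fract_lt_one y).le⟩
  have h3 : ‖H (u, y)‖ ≤ R := hR _ hz
  rw [Real.norm_eq_abs] at h2 h3
  have h4 : |(⌊y⌋ : ℝ)| ≤ |(k : ℝ) * ⌊y⌋| := by
    rw [abs_mul]
    have : (1 : ℝ) ≤ |(k : ℝ)| := by exact_mod_cast Int.one_le_abs hk0
    nlinarith [abs_nonneg (⌊y⌋ : ℝ)]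
  have h5 : |(k : ℝ) * ⌊y⌋| ≤ R + M := by
    have : (k : ℝ) * ⌊y⌋ = H (u, y) - H (u, Int.fract y) := by linarith
    rw [this]
    exact (abs_sub _ _).trans (add_le_add h3 h2)
  have h6 := abs_le.1 (h4.trans h5)
  have h7 := Int.floor_le y
  have h8 := (Int.lt_floor_add_one y).le
  exact ⟨trivial, by simp only; linarith, by simp only; linarith⟩

/-- The level sets in the annulus of a lifted horizontal map are connected. -/
lemma isPreconnected_level {h : 𝕋2 → 𝕊} (hh : IsHorizontalMap h) {H : 𝔸 → ℝ}
    (hH : Continuous H) (hHh : ∀ z, (H z : 𝕊) = h (θ z)) {k : ℤ}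
    (hk : ∀ u y, H (u, y + 1) = H (u, y) + k) (hk0 : k ≠ 0) (s : ℝ) :
    IsPreconnected (H ⁻¹' {s}) := by
  have hprop := isProperMap_of_degree hH hk hk0
  have hcpt : ∀ r, IsCompact (H ⁻¹' {r}) := fun r => hprop.isCompact_preimage isCompact_singleton
  rw [isPreconnected_closed_iff]
  rintro A B hA hB hsub ⟨a, has, haA⟩ ⟨b, hbs, hbB⟩
  by_contra hne
  rw [Set.not_nonempty_iff_eq_empty] at hne
  set S : Set 𝔸 := ⋃ r ∈ Finset.Ioo 0 |k|, H ⁻¹' {s + r} with hS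
  have hScpt : IsCompact S := (Finset.Ioo 0 |k|).isCompact_biUnion fun r _ => hcpt _
  have hA' : IsClosed (θ '' (H ⁻¹' {s} ∩ A)) :=
    (((hcpt s).inter_right hA).image isOpenQuotientMap_θ.continuous).isClosed
  have hB' : IsClosed (θ '' (H ⁻¹' {s} ∩ B) ∪ θ '' S) :=
    (((hcpt s).inter_right hB).image isOpenQuotientMap_θ.continuous).isClosed.union
      (hScpt.image isOpenQuotientMap_θ.continuous).isClosed
  obtain ⟨q, -, hqA, hqB⟩ := isPreconnected_closed_iff.1 (isPreconnected_fiber hh (s : 𝕊)) _ _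
    hA' hB' (by
      intro q hq
      obtain ⟨⟨u, y⟩, rfl⟩ := isOpenQuotientMap_θ.surjective q
      obtain ⟨j, hj⟩ := exists_int_add_of_coe_eq ((hHh (u, y)).trans hq)
      have hθ : θ (u, y + ((-(j / k) : ℤ) : ℝ)) = θ (u, y) := by
        simp only [θ, coe_add_int]
      have hval : H (u, y + ((-(j / k) : ℤ) : ℝ)) = s + ((j % k : ℤ) : ℝ) := by
        rw [add_int_vertical hk, hj, Int.emod_def]
        push_cast
        ring
      rw [← hθ]
      rcases (Int.emod_nonneg j hk0).eq_or_lt with h0 | h0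
      · rw [← h0, Int.cast_zero, add_zero] at hval
        rcases hsub hval with h1 | h1
        · exact Or.inl ⟨_, ⟨hval, h1⟩, rfl⟩
        · exact Or.inr (Or.inl ⟨_, ⟨hval, h1⟩, rfl⟩)
      · refine Or.inr (Or.inr ⟨_, ?_, rfl⟩)
        rw [hS]
        simp only [mem_iUnion]
        exact ⟨j % k, Finset.mem_Ioo.2 ⟨h0, Int.emod_lt_abs j hk0⟩, hval⟩)
    ⟨θ a, by rw [mem_preimage, ← hHh, has]; rfl, a, ⟨has, haA⟩, rfl⟩
    ⟨θ b, by rw [mem_preimage, ← hHh, hbs]; rfl, Or.inl ⟨b, ⟨hbs, hbB⟩, rfl⟩⟩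
  obtain ⟨⟨u, y⟩, ⟨hws, hwA⟩, rfl⟩ := hqA
  have hθeq : ∀ w : 𝔸, θ w = θ (u, y) → ∃ l : ℤ, w = (u, y + l) := by
    rintro ⟨u', y'⟩ hw
    simp only [θ, Prod.mk.injEq] at hw
    obtain ⟨rfl, hw⟩ := hw
    obtain ⟨l, rfl⟩ := exists_int_add_of_coe_eq hw
    exact ⟨l, rfl⟩
  simp only [mem_preimage, mem_singleton_iff] at hws
  rcases hqB with ⟨w, ⟨hw, hwB⟩, hwθ⟩ | ⟨w, hw, hwθ⟩
  · obtain ⟨l, rfl⟩ := hθeq w hwθ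
    simp only [mem_preimage, mem_singleton_iff] at hw
    rw [add_int_vertical hk, hws] at hw
    have : (k : ℝ) * l = 0 := by linarith
    have : k * l = 0 := by exact_mod_cast this
    have hl : l = 0 := (mul_eq_zero.1 this).resolve_left hk0
    subst hl
    rw [Int.cast_zero, add_zero] at hwB
    exact (hne ▸ ⟨hws, hwA, hwB⟩ : (u, y) ∈ (∅ : Set 𝔸))
  · obtain ⟨l, rfl⟩ := hθeq w hwθ
    rw [hS] at hw
    simp only [mem_iUnion, mem_preimage, mem_singleton_iff, Finset.mem_Ioo] at hw
    obtain ⟨r, ⟨hr0, hr1⟩, hw⟩ := hw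
    rw [add_int_vertical hk, hws] at hw
    have : (r : ℝ) = k * l := by linarith
    have : r = k * l := by exact_mod_cast this
    have hdvd : |k| ∣ r := (abs_dvd _ _).2 ⟨l, this⟩
    exact absurd (Int.le_of_dvd hr0 hdvd) (not_le.2 hr1)

/-- Closed surjections with connected fibers pull back closed connected sets to connected sets. -/
lemma isPreconnected_preimage_of_fibers {X Y : Type*} [TopologicalSpace X] [TopologicalSpace Y]
    {H : X → Y} (hH : Continuous H) (hcl : IsClosedMap H) (hsurj : Function.Surjective H)
    (hfib : ∀ y, IsPreconnected (H ⁻¹' {y})) {T : Set Y} (hT : IsPreconnected T)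
    (hTc : IsClosed T) : IsPreconnected (H ⁻¹' T) := by
  rw [isPreconnected_closed_iff]
  rintro A B hA hB hsub ⟨a, haT, haA⟩ ⟨b, hbT, hbB⟩
  have hTc' := hTc.preimage hH
  obtain ⟨t, ht, ⟨x, ⟨hxA, hxT⟩, hx⟩, ⟨x', ⟨hxB, hxT'⟩, hx'⟩⟩ := isPreconnected_closed_iff.1 hT _ _
    (hcl _ (hA.inter hTc')) (hcl _ (hB.inter hTc')) (by
      intro t ht
      obtain ⟨x, rfl⟩ := hsurj t
      rcases hsub ht with h | h
      · exact Or.inl ⟨x, ⟨h, ht⟩, rfl⟩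
      · exact Or.inr ⟨x, ⟨h, ht⟩, rfl⟩)
    ⟨H a, haT, a, ⟨haA, haT⟩, rfl⟩ ⟨H b, hbT, b, ⟨hbB, hbT⟩, rfl⟩
  obtain ⟨z, hz, hzAB⟩ := isPreconnected_closed_iff.1 (hfib t) A B hA hB
    (fun w hw => hsub (by rw [mem_preimage, (hw : H w = t)]; exact ht))
    ⟨x, hx, hxA⟩ ⟨x', hx', hxB⟩
  exact ⟨z, by rw [mem_preimage, (hz : H z = t)]; exact ht, hzAB⟩

/-- A connected set avoiding an essential continuum is not unbounded on both sides. -/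
lemma IsEssentialContinuum.not_unbounded_both {E W : Set 𝔸} (hE : IsEssentialContinuum E)
    (hW : IsPreconnected W) (hdisj : W ⊆ Eᶜ) (hup : UnbAbove W) (hlow : UnbBelow W) : False := by
  obtain ⟨-, -, U, V, -, -, -, -, hU, -, hV, hall⟩ := hE
  have hne : W.Nonempty := by
    by_contra hemp
    rw [Set.not_nonempty_iff_eq_empty] at hemp
    exact hup (by simp [hemp])
  obtain ⟨w, hw⟩ := hne
  have hsub := hW.subset_connectedComponentIn hw hdisj
  have hup' : UnbAbove (connectedComponentIn Eᶜ w) := fun hb => hup (hb.mono (image_mono hsub))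
  have hlow' : UnbBelow (connectedComponentIn Eᶜ w) := fun hb => hlow (hb.mono (image_mono hsub))
  rcases hall _ ⟨w, hdisj hw, rfl⟩ (fun hb => hup' (LipschitzWith.prod_snd.isBounded_image hb).bddAbove)
    with h | h
  · exact hU (h ▸ hlow')
  · exact hV (h ▸ hup')

/-- A connected set on which a lifted horizontal map crosses the range of values taken on an
essential continuum meets that continuum. -/
lemma IsEssentialContinuum.inter_nonempty_of_crossing {H : 𝔸 → ℝ} (hH : Continuous H) {k : ℤ}
    (hk : ∀ u y, H (u, y + 1) = H (u, y) + k) (hk0 : k ≠ 0)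
    (hlevel : ∀ s, IsPreconnected (H ⁻¹' {s})) {E D : Set 𝔸} (hE : IsEssentialContinuum E)
    (hD : IsPreconnected D) {x y : 𝔸} (hx : x ∈ D) (hy : y ∈ D)
    (hEx : ∀ e ∈ E, H x < H e) (hEy : ∀ e ∈ E, H e < H y) : (D ∩ E).Nonempty := by
  have hsurj : Function.Surjective H := by
    intro s
    have hkk : (1 : ℝ) ≤ k * k := by
      have : 1 ≤ k * k := by nlinarith [Int.one_le_abs hk0, abs_mul_abs_self k]
      exact_mod_cast this
    obtain ⟨N, hN⟩ := exists_nat_ge |s - H 0|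
    have hN' := abs_le.1 hN
    have hN0 : (0 : ℝ) ≤ N := N.cast_nonneg
    refine mem_range_of_exists_le_of_exists_ge hH
      ⟨((0 : 𝔸).1, (0 : 𝔸).2 + ((-(k * N) : ℤ) : ℝ)), ?_⟩
      ⟨((0 : 𝔸).1, (0 : 𝔸).2 + ((k * N : ℤ) : ℝ)), ?_⟩
    all_goals
      rw [add_int_vertical hk]
      push_cast
      simp only [Prod.mk.eta]
      nlinarith
  have hcl := (isProperMap_of_degree hH hk hk0).isClosedMap
  by_contra hne
  have hDE : ∀ z ∈ D, z ∉ E := fun z hz hzE => hne ⟨z, hz, hzE⟩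
  set W : Set 𝔸 := (H ⁻¹' Iic (H x) ∪ D) ∪ H ⁻¹' Ici (H y) with hW
  have hWpre : IsPreconnected W :=
    ((isPreconnected_preimage_of_fibers hH hcl hsurj hlevel isPreconnected_Iic isClosed_Iic).union
      x (le_refl (H x)) hx hD).union y (Or.inr hy) (le_refl (H y))
      (isPreconnected_preimage_of_fibers hH hcl hsurj hlevel isPreconnected_Ici isClosed_Ici)
  have hWE : W ⊆ Eᶜ := by
    rintro z ((hz | hz) | hz) hzE
    · exact absurd (hEx z hzE) (not_lt.2 hz)
    · exact hDE z hz hzE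
    · exact absurd (hEy z hzE) (not_lt.2 hz)
  have hmem : ∀ l : ℤ, (x.1, x.2 + (l : ℝ)) ∈ W ∨ (y.1, y.2 + (l : ℝ)) ∈ W := by
    intro l
    rcases le_total ((k : ℝ) * l) 0 with h | h
    · refine Or.inl (Or.inl (Or.inl ?_))
      rw [mem_preimage, add_int_vertical hk, mem_Iic]
      simpa using h
    · refine Or.inr (Or.inr ?_)
      rw [mem_preimage, add_int_vertical hk, mem_Ici]
      simpa using h
  refine hE.not_unbounded_both hWpre hWE ?_ ?_
  · refine not_bddAbove_iff.2 fun B => ?_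
    obtain ⟨l, hl⟩ := exists_int_gt (B - min x.2 y.2)
    have h1 := min_le_left x.2 y.2
    have h2 := min_le_right x.2 y.2
    rcases hmem l with h | h
    · exact ⟨_, ⟨_, h, rfl⟩, by simp only; linarith⟩
    · exact ⟨_, ⟨_, h, rfl⟩, by simp only; linarith⟩
  · refine not_bddBelow_iff.2 fun B => ?_
    obtain ⟨l, hl⟩ := exists_int_lt (B - max x.2 y.2)
    have h1 := le_max_left x.2 y.2
    have h2 := le_max_right x.2 y.2
    rcases hmem l with h | h
    · exact ⟨_, ⟨_, h, rfl⟩, by simp only; linarith⟩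
    · exact ⟨_, ⟨_, h, rfl⟩, by simp only; linarith⟩

lemma dist_τ_le (p q : ℝ × ℝ) : dist (τ p) (τ q) ≤ dist p q := by
  rw [Prod.dist_eq, Prod.dist_eq]
  refine max_le_max ?_ le_rfl
  simp only [τ]
  rw [dist_eq_norm, dist_eq_norm, ← AddCircle.coe_sub]
  exact QuotientAddGroup.norm_mk_le_norm

/-- Outside a finite set of values modulo one, every point has a small connected neighborhood
on which a lifted horizontal map crosses the given interval of values. -/
lemma exists_finite_critical {H : 𝔸 → ℝ} (hH : Continuous H) {k : ℤ}
    (hk : ∀ u y, H (u, y + 1) = H (u, y) + k) {ρ : ℝ} (hρ : 0 < ρ) :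
    ∃ F : Finset 𝕊, ∀ s t : ℝ, (∀ c ∈ Icc s t, (c : 𝕊) ∉ F) → ∀ z, H z ∈ Icc s t →
      ∃ D : Set 𝔸, IsPreconnected D ∧ (∀ w ∈ D, dist z w ≤ 2 * ρ) ∧
        (∃ x ∈ D, H x < s) ∧ ∃ y ∈ D, t < H y := by
  classical
  have hHτ : Continuous (H ∘ τ) := hH.comp isOpenQuotientMap_τ.continuous
  have hmin : ∀ p : ℝ × ℝ, ∃ q ∈ closedBall p ρ, ∀ r ∈ closedBall p ρ, H (τ q) ≤ H (τ r) :=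
    fun p => (isCompact_closedBall p ρ).exists_isMinOn (nonempty_closedBall.2 hρ.le)
      hHτ.continuousOn
  have hmax : ∀ p : ℝ × ℝ, ∃ q ∈ closedBall p ρ, ∀ r ∈ closedBall p ρ, H (τ r) ≤ H (τ q) :=
    fun p => (isCompact_closedBall p ρ).exists_isMaxOn (nonempty_closedBall.2 hρ.le)
      hHτ.continuousOn
  choose m hm hm' using hmin
  choose M hM hM' using hmax
  obtain ⟨T, -, hTfin, hT⟩ := finite_cover_balls_of_compact
    ((isCompact_Icc (a := (0:ℝ)) (b := 1)).prod (isCompact_Icc (a := (0:ℝ)) (b := 1))) hρ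
  refine ⟨hTfin.toFinset.image (fun p => (H (τ (m p)) : 𝕊)) ∪
    hTfin.toFinset.image (fun p => (H (τ (M p)) : 𝕊)), ?_⟩
  intro s t hF z hz
  obtain ⟨⟨x, y⟩, rfl⟩ := isOpenQuotientMap_τ.surjective z
  set p₀ : ℝ × ℝ := (Int.fract x, Int.fract y) with hp₀
  obtain ⟨p, hpT, hp⟩ := mem_iUnion₂.1 (hT (show p₀ ∈ _ from
    ⟨⟨Int.fract_nonneg x, (Int.fract_lt_one x).le⟩, Int.fract_nonneg y, (Int.fract_lt_one y).le⟩))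
  set σ : ℝ × ℝ → 𝔸 := fun q => τ (q + (0, (⌊y⌋ : ℝ))) with hσ
  have hσH : ∀ q, H (σ q) = H (τ q) + k * ⌊y⌋ := by
    intro q
    simp only [hσ, τ, Prod.fst_add, Prod.snd_add, add_zero]
    exact add_int_vertical hk _ _ _
  have hcoe : ∀ q, ((H (σ q) : ℝ) : 𝕊) = H (τ q) := by
    intro q
    rw [hσH]
    exact_mod_cast coe_add_int (H (τ q)) (k * ⌊y⌋)
  have hz₀ : σ p₀ = τ (x, y) := by
    simp only [hσ, hp₀, τ, Prod.mk_add_mk, add_zero, Int.fract_add_floor]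
    rw [← coe_add_int (Int.fract x) ⌊x⌋, Int.fract_add_floor]
  rw [← hz₀] at hz ⊢
  have hpc : p₀ ∈ closedBall p ρ := ball_subset_closedBall hp
  refine ⟨σ '' closedBall p ρ, ?_, ?_, ⟨σ (m p), ⟨m p, hm p, rfl⟩, ?_⟩,
    ⟨σ (M p), ⟨M p, hM p, rfl⟩, ?_⟩⟩
  · refine (convex_closedBall p ρ).isPreconnected.image _ (Continuous.continuousOn ?_)
    exact isOpenQuotientMap_τ.continuous.comp (by fun_prop)
  · rintro _ ⟨q, hq, rfl⟩
    refine (dist_τ_le _ _).trans ?_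
    rw [dist_add_right]
    have h1 := mem_closedBall.1 hpc
    have h2 := mem_closedBall'.1 hq
    linarith [dist_triangle p₀ p q]
  · by_contra! hle
    have h1 := hm' p p₀ hpc
    refine hF (H (σ (m p))) ⟨hle, ?_⟩ ?_
    · have := hz.2
      rw [hσH] at this ⊢
      linarith
    · rw [hcoe]
      exact Finset.mem_union_left _ (Finset.mem_image.2 ⟨p, hTfin.mem_toFinset.2 hpT, rfl⟩)
  · by_contra! hle
    have h1 := hM' p p₀ hpc
    refine hF (H (σ (M p))) ⟨?_, hle⟩ ?_
    · have := hz.1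
      rw [hσH] at this ⊢
      linarith
    · rw [hcoe]
      exact Finset.mem_union_right _ (Finset.mem_image.2 ⟨p, hTfin.mem_toFinset.2 hpT, rfl⟩)

lemma uw_le {A : Set 𝔸} {r : ℝ} (hr : 0 ≤ r)
    (hA : ∀ E E' : Set 𝔸, IsEssentialContinuum E → E ⊆ A → E' ⊆ A →
      ∀ z ∈ E', ∃ w ∈ E, dist z w ≤ r) : uw A ≤ r := by
  refine Real.sSup_le ?_ hr
  rintro _ ⟨C₁, C₂, h₁, h₂, hs₁, hs₂, rfl⟩
  exact hausdorffDist_le_of_mem_dist hr (hA C₂ C₁ h₂ hs₂ hs₁) (hA C₁ C₂ h₁ hs₁ hs₂)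

/-- A connected set of reals lying over a short arc lies in a single lift of that arc. -/
lemma exists_subset_Icc_of_isPreconnected {S : Set ℝ} (hS : IsPreconnected S) {a b : ℝ}
    (hab : b - a < 1) (hsub : ∀ s ∈ S, (s : 𝕊) ∈ (fun x : ℝ => (x : 𝕊)) '' Icc a b) :
    ∃ j : ℤ, S ⊆ Icc (a + j) (b + j) := by
  rcases S.eq_empty_or_nonempty with rfl | ⟨s, hs⟩
  · exact ⟨0, by simp⟩
  have hint : ∀ s ∈ S, ∃ j : ℤ, s ∈ Icc (a + j) (b + j) := by
    intro s hs
    obtain ⟨c, hc, hcs⟩ := hsub s hs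
    obtain ⟨j, rfl⟩ := exists_int_add_of_coe_eq hcs.symm
    exact ⟨j, by simpa using hc⟩
  have hgap : ∀ w : ℝ, ∀ j : ℤ, b + j < w → w < a + j + 1 → w ∉ S := by
    intro w j h1 h2 hw
    obtain ⟨i, hi1, hi2⟩ := hint w hw
    have h3 : (i : ℝ) < (j + 1 : ℤ) := by push_cast; linarith
    have h4 : (j : ℝ) < i := by linarith
    have h3' : i < j + 1 := by exact_mod_cast h3
    have h4' : j < i := by exact_mod_cast h4
    omega
  obtain ⟨j, hj1, hj2⟩ := hint s hs
  refine ⟨j, fun v hv => ⟨?_, ?_⟩⟩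
  · by_contra! hlt
    obtain ⟨w, hw1, hw2⟩ := exists_between (max_lt hlt (by linarith : b + j - 1 < a + j))
    have hwS : w ∈ S := hS.ordConnected.out hv hs ⟨(le_max_left _ _).trans hw1.le, by linarith⟩
    have := le_max_right v (b + j - 1)
    exact hgap w (j - 1) (by push_cast; linarith) (by push_cast; linarith) hwS
  · by_contra! hlt
    obtain ⟨w, hw1, hw2⟩ := exists_between (lt_min hlt (by linarith : b + j < a + j + 1))
    have hwS : w ∈ S := hS.ordConnected.out hs hv ⟨by linarith, hw2.le.trans (min_le_left _ _)⟩
    exact hgap w j hw1 (hw2.trans_le (min_le_right _ _)) hwS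

/-- Preimages of short arcs avoiding a finite set have small upper width. -/
lemma IsHorizontalMap.exists_finite_uw_lt {h : 𝕋2 → 𝕊} (hh : IsHorizontalMap h) {ε : ℝ}
    (hε : 0 < ε) : ∃ F : Finset 𝕊, ∀ a b : ℝ, b - a < 1 →
      (∀ q ∈ F, q ∉ (fun x : ℝ => (x : 𝕊)) '' Icc a b) →
      ∀ S ⊆ h ⁻¹' ((fun x : ℝ => (x : 𝕊)) '' Icc a b), ∀ z,
        uw (connectedComponentIn (θ ⁻¹' S) z) < ε := by
  obtain ⟨H, k, hH, hHh, hk, hk0⟩ := hh.exists_lift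
  obtain ⟨F, hF⟩ := exists_finite_critical hH hk (ρ := ε / 4) (by linarith)
  refine ⟨F, fun a b hab hFab S hS z => ?_⟩
  refine lt_of_le_of_lt (uw_le (r := 2 * (ε / 4)) (by linarith) ?_) (by linarith)
  obtain ⟨j, hj⟩ := exists_subset_Icc_of_isPreconnected
    (isPreconnected_connectedComponentIn.image H hH.continuousOn) hab (by
      rintro _ ⟨w, hw, rfl⟩
      rw [hHh]
      exact hS (connectedComponentIn_subset (θ ⁻¹' S) z hw))
  have hvals : ∀ w ∈ connectedComponentIn (θ ⁻¹' S) z, H w ∈ Icc (a + j) (b + j) :=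
    fun w hw => hj ⟨w, hw, rfl⟩
  intro E E' hE hEsub hE'sub w hw
  obtain ⟨D, hD, hDdist, ⟨x, hxD, hx⟩, y, hyD, hy⟩ := hF (a + j) (b + j) (by
    intro c hc hcF
    refine hFab _ hcF ⟨c - j, ⟨by linarith [hc.1], by linarith [hc.2]⟩, ?_⟩
    simp) w (hvals w (hE'sub hw))
  obtain ⟨e, heD, heE⟩ := hE.inter_nonempty_of_crossing hH hk hk0
    (isPreconnected_level hh hH hHh hk hk0) hD hxD hyD
    (fun e he => hx.trans_le (hvals e (hEsub he)).1) (fun e he => (hvals e (hEsub he)).2.trans_lt hy)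
  exact ⟨e, heE, hDdist e heD⟩

/-- The times at which a short arc, moved by an irrational rotation, avoids a given finite set
have lower density close to one. -/
lemma exists_le_lowerDensity (F : Finset 𝕊) {α : ℝ} (hα : Irrational α) {δ : ℝ} (hδ : 0 < δ) :
    ∃ η > (0:ℝ), η ≤ 1 ∧ ∀ a b : ℝ, b - a < η → ∀ G : Set ℕ,
      (∀ n : ℕ, (∀ q ∈ F, q ∉ (fun x : ℝ => (x : 𝕊)) '' Icc (a + n * α) (b + n * α)) → n ∈ G) →
      1 - δ ≤ lowerDensity G := by
  classical
  obtain ⟨K, hK⟩ := exists_nat_gt (max 0 (F.card / (δ / 2)))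
  have hK0 : (0 : ℝ) < K := (le_max_left _ _).trans_lt hK
  have hK0' : 0 < K := by exact_mod_cast hK0
  have hFK : (F.card : ℝ) < K * (δ / 2) :=
    (div_lt_iff₀ (by linarith)).1 ((le_max_right _ _).trans_lt hK)
  have hnorm : ∀ j ∈ Finset.Ioo 0 K, 0 < ‖((j * α : ℝ) : 𝕊)‖ := by
    intro j hj
    rw [norm_pos_iff]
    intro h0
    obtain ⟨d, hd⟩ := exists_int_add_of_coe_eq (h0.trans (AddCircle.coe_zero (p := (1:ℝ))).symm)
    have hj0 : (j : ℚ) ≠ 0 := by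
      have := (Finset.mem_Ioo.1 hj).1
      positivity
    refine (hα.ratCast_mul hj0).ne_int d ?_
    push_cast
    linarith
  have hev : ∀ᶠ η in 𝓝[>] (0:ℝ), ∀ j ∈ Finset.Ioo 0 K, η < ‖((j * α : ℝ) : 𝕊)‖ :=
    (Filter.eventually_all_finset _).2 fun j hj =>
      (eventually_lt_nhds (hnorm j hj)).filter_mono nhdsWithin_le_nhds
  obtain ⟨η, hη, hη1, hη0⟩ := (hev.and (((eventually_le_nhds (zero_lt_one (α := ℝ))).filter_mono
    nhdsWithin_le_nhds).and self_mem_nhdsWithin)).exists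
  refine ⟨η, hη0, hη1, fun a b hab G hG => ?_⟩
  set B : 𝕊 → ℕ → Prop := fun q n => q ∈ (fun x : ℝ => (x : 𝕊)) '' Icc (a + n * α) (b + n * α)
    with hB
  have hsep : ∀ q, ∀ n n' : ℕ, B q n → B q n' → n < n' → K ≤ n' - n := by
    rintro q n n' ⟨c, hc, rfl⟩ ⟨c', hc', hcc⟩ hlt
    by_contra! hKlt
    have h1 := hη (n' - n) (Finset.mem_Ioo.2 ⟨by omega, hKlt⟩)
    have h2 : ((((n' - n : ℕ) : ℝ) * α : ℝ) : 𝕊) = (((c - n * α) - (c' - n' * α) : ℝ) : 𝕊) := by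
      simp only at hcc
      rw [Nat.cast_sub hlt.le]
      have : (c - n * α) - (c' - n' * α) = (((n' : ℝ) - n) * α) + (c - c') := by ring
      rw [this, AddCircle.coe_add, AddCircle.coe_sub, hcc, sub_self, add_zero]
    rw [h2] at h1
    have h3 : ‖(((c - n * α) - (c' - n' * α) : ℝ) : 𝕊)‖ ≤ |(c - n * α) - (c' - n' * α)| :=
      QuotientAddGroup.norm_mk_le_norm
    have h4 : |(c - n * α) - (c' - n' * α)| ≤ b - a :=
      abs_le.2 ⟨by linarith [hc.1, hc'.2], by linarith [hc.2, hc'.1]⟩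
    linarith
  have hcount : ∀ q, ∀ n : ℕ, ((Finset.Icc 1 n).filter (B q)).card ≤ n / K + 1 := by
    intro q n
    rw [← Finset.card_range (n / K + 1)]
    refine Finset.card_le_card_of_injOn (· / K) ?_ ?_
    · intro i hi
      have := (Finset.mem_Icc.1 (Finset.mem_filter.1 hi).1).2
      exact Finset.mem_coe.2 (Finset.mem_range.2 (Nat.lt_succ_of_le (Nat.div_le_div_right this)))
    · intro i hi i' hi' hii
      have hBi := (Finset.mem_filter.1 hi).2
      have hBi' := (Finset.mem_filter.1 hi').2
      simp only at hii
      have e1 := Nat.div_add_mod i K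
      have e2 := Nat.div_add_mod i' K
      have m1 := Nat.mod_lt i hK0'
      have m2 := Nat.mod_lt i' hK0'
      rw [hii] at e1
      rcases lt_trichotomy i i' with hlt | heq | hlt
      · have := hsep q i i' hBi hBi' hlt
        omega
      · exact heq
      · have := hsep q i' i hBi' hBi hlt
        omega
  have htotal : ∀ n : ℕ, n ≤ (G ∩ Set.Icc 1 n).ncard + F.card * (n / K + 1) := by
    intro n
    have hsub : Finset.Icc 1 n ⊆ (Finset.Icc 1 n).filter (· ∈ G) ∪
        F.biUnion fun q => (Finset.Icc 1 n).filter (B q) := by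
      intro i hi
      by_cases hiG : i ∈ G
      · exact Finset.mem_union_left _ (Finset.mem_filter.2 ⟨hi, hiG⟩)
      · refine Finset.mem_union_right _ ?_
        have : ∃ q ∈ F, B q i := by
          by_contra! hno
          exact hiG (hG i hno)
        obtain ⟨q, hq, hqi⟩ := this
        exact Finset.mem_biUnion.2 ⟨q, hq, Finset.mem_filter.2 ⟨hi, hqi⟩⟩
    have h1 := (Finset.card_le_card hsub).trans (Finset.card_union_le _ _)
    rw [Nat.card_Icc, Nat.add_sub_cancel] at h1
    have h2 : (G ∩ Set.Icc 1 n).ncard = ((Finset.Icc 1 n).filter (· ∈ G)).card := by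
      rw [← Set.ncard_coe_finset]
      congr 1
      ext i
      simp
      tauto
    have h3 : (F.biUnion fun q => (Finset.Icc 1 n).filter (B q)).card ≤ F.card * (n / K + 1) :=
      Finset.card_biUnion_le_card_mul _ _ _ fun q _ => hcount q n
    omega
  refine le_liminf_of_le ?_ ?_
  · refine Filter.IsBoundedUnder.isCoboundedUnder_ge ⟨1, ?_⟩
    rw [Filter.eventually_map]
    refine Filter.Eventually.of_forall fun n => div_le_one_of_le₀ ?_ n.cast_nonneg
    have := Set.ncard_le_ncard (s := G ∩ Set.Icc 1 n) Set.inter_subset_right (Set.finite_Icc 1 n)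
    rw [← Finset.coe_Icc, Set.ncard_coe_finset, Nat.card_Icc, Nat.add_sub_cancel] at this
    rw [← Finset.coe_Icc]
    exact_mod_cast this
  · obtain ⟨N, hN⟩ := exists_nat_gt (F.card / (δ / 2))
    filter_upwards [eventually_ge_atTop (max N 1)] with n hn
    have hn1 : (0 : ℝ) < n := by exact_mod_cast (le_max_right N 1).trans hn
    have hnN : (N : ℝ) ≤ n := by exact_mod_cast (le_max_left N 1).trans hn
    rw [le_div_iff₀ hn1]
    have h1 : (n : ℝ) ≤ (G ∩ Set.Icc 1 n).ncard + F.card * ((n / K : ℕ) + 1) := by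
      exact_mod_cast htotal n
    have h2 : ((n / K : ℕ) : ℝ) ≤ n / K := Nat.cast_div_le
    have h3 : (F.card : ℝ) * ((n / K : ℕ) : ℝ) ≤ δ / 2 * n := by
      calc (F.card : ℝ) * ((n / K : ℕ) : ℝ) ≤ (K * (δ / 2)) * (n / K) := by gcongr
        _ = δ / 2 * n := by field_simp
    have h4 : (F.card : ℝ) ≤ δ / 2 * n := by
      have := (div_lt_iff₀ (by linarith : 0 < δ / 2)).1 hN
      nlinarith
    linarith

theorem upper_width_small_with_high_frequency
    (f : 𝕋2 → 𝕋2) (hf : IsHomeomorph f)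
    (hhtpy : ContinuousMap.Homotopic ⟨f, hf.continuous⟩ (ContinuousMap.id 𝕋2))
    (h : 𝕋2 → 𝕊) (hh : IsHorizontalMap h)
    (α : ℝ) (hα : Irrational α)
    (hsemi : ∀ z, h (f z) = h z + (α : 𝕊)) :
    ∀ ε > (0:ℝ), ∀ δ > (0:ℝ), ∃ η > (0:ℝ), ∀ a b : ℝ, a ≤ b → b - a < η →
      1 - δ ≤ lowerDensity
        {n : ℕ |
          ∀ z ∈ θ ⁻¹' (f^[n] '' (h ⁻¹' ((fun x : ℝ => (x : 𝕊)) '' Set.Icc a b))),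
            uw (connectedComponentIn
              (θ ⁻¹' (f^[n] '' (h ⁻¹' ((fun x : ℝ => (x : 𝕊)) '' Set.Icc a b)))) z) < ε} := by
  intro ε hε δ hδ
  obtain ⟨F, hF⟩ := hh.exists_finite_uw_lt hε
  obtain ⟨η, hη0, hη1, hη⟩ := exists_le_lowerDensity F hα hδ
  refine ⟨η, hη0, fun a b _ hab => hη a b hab _ fun n hn z _ => ?_⟩
  refine hF _ _ (by linarith) hn _ ?_ z
  have hiter : ∀ (n : ℕ) (w : 𝕋2), h (f^[n] w) = h w + ((n * α : ℝ) : 𝕊) := by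
    intro n
    induction n with
    | zero => simp
    | succ n ih =>
      intro w
      rw [Function.iterate_succ_apply', hsemi, ih, add_assoc, ← AddCircle.coe_add]
      congr 2
      push_cast
      ring
  rintro _ ⟨w, ⟨c, hc, hcw⟩, rfl⟩
  refine ⟨c + n * α, ⟨by linarith [hc.1], by linarith [hc.2]⟩, ?_⟩
  rw [hiter, ← hcw]
  exact AddCircle.coe_add ..
end
end
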